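/- arXiv:1511.07231 — 3 statements merged into one kernel-verified Lean document; each statement's English description precedes it below -/
import Mathlib

section
/- Let n, m ≥ 1 and let φ : ℝⁿ → ℝᵐ be a smooth map that is biharmonic in the flat sense, i.e. Δ(Δφ) = 0 everywhere, where Δ denotes the Euclidean Laplacian acting componentwise (equivalently, the sum of the second directional derivatives along an orthonormal basis of ℝⁿ). If ∫_{ℝⁿ} ‖Δφ(x)‖^p dx < ∞ for some real p with 1 < p < ∞, then Δφ = 0 identically, i.e. φ is harmonic. -/
open MeasureTheory

/-- The Euclidean Laplacian of a map `f : ℝⁿ → F`, acting componentwise: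
the sum of the second directional derivatives along the standard orthonormal
basis of `ℝⁿ`. -/
noncomputable def eLap {n : ℕ} {F : Type*} [NormedAddCommGroup F] [NormedSpace ℝ F]
    (f : EuclideanSpace ℝ (Fin n) → F) (x : EuclideanSpace ℝ (Fin n)) : F :=
  ∑ i : Fin n,
    fderiv ℝ (fderiv ℝ f) x (EuclideanSpace.single i 1) (EuclideanSpace.single i 1)

open scoped Topology

lemma hasDerivAt_max_zero_sq (s : ℝ) :
    HasDerivAt (fun s : ℝ => max 0 s ^ 2) (2 * max 0 s) s := by
  rcases lt_trichotomy s 0 with hs | rfl | hs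
  · rw [max_eq_left hs.le, mul_zero]
    refine (hasDerivAt_const s (0 : ℝ)).congr_of_eventuallyEq ?_
    filter_upwards [eventually_lt_nhds hs] with u hu
    simp [hu.le]
  · have h : (fun s : ℝ => max 0 s ^ 2) =O[𝓝 0] fun s => ‖s - 0‖ ^ 2 := by
      refine .of_bound 1 (.of_forall fun u => ?_)
      rcases le_total u 0 with hu | hu <;> simp [hu, sq_nonneg]
    simpa using (h.hasFDerivAt one_lt_two).hasDerivAt
  · rw [max_eq_right hs.le]
    have h : HasDerivAt (fun s : ℝ => s ^ 2) (2 * s) s := by simpa using hasDerivAt_pow 2 s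
    refine h.congr_of_eventuallyEq ?_
    filter_upwards [eventually_gt_nhds hs] with u hu
    rw [max_eq_right hu.le]

section RadialKernel

variable {E : Type*} [NormedAddCommGroup E]

/-- The tent function of `‖y‖ ^ 2`, a continuous radial kernel supported in the unit ball. -/
noncomputable def radialTent (y : E) : ℝ := max 0 (1 - ‖y‖ ^ 2)

lemma continuous_radialTent : Continuous (radialTent : E → ℝ) := by
  unfold radialTent; fun_prop

lemma radialTent_nonneg (y : E) : 0 ≤ radialTent y := le_max_left _ _

lemma radialTent_eq_zero {y : E} (hy : y ∉ Metric.closedBall (0 : E) 1) : radialTent y = 0 := by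
  rw [mem_closedBall_zero_iff, not_le] at hy
  exact max_eq_left (by nlinarith)

lemma hasCompactSupport_radialTent [ProperSpace E] :
    HasCompactSupport (radialTent : E → ℝ) :=
  HasCompactSupport.intro (isCompact_closedBall 0 1) fun _ => radialTent_eq_zero

variable [InnerProductSpace ℝ E]

/-- The kernel `radialTent y • y` is a gradient, up to a constant factor. -/
lemma hasFDerivAt_radialTent_sq (y : E) :
    HasFDerivAt (fun y : E => radialTent y ^ 2) ((-4 * radialTent y) • innerSL ℝ y) y := by
  have h : HasFDerivAt (fun y : E => 1 - ‖y‖ ^ 2) (-(2 • innerSL ℝ y)) y :=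
    (hasStrictFDerivAt_norm_sq y).hasFDerivAt.const_sub 1
  refine ((hasDerivAt_max_zero_sq (1 - ‖y‖ ^ 2)).comp_hasFDerivAt y h).congr_fderiv ?_
  ext v
  simp [radialTent]
  ring

lemma integral_radialTent_pos [FiniteDimensional ℝ E] [MeasurableSpace E] [BorelSpace E]
    (μ : Measure E) [IsFiniteMeasureOnCompacts μ] [μ.IsOpenPosMeasure] :
    0 < ∫ y, radialTent y ∂μ :=
  continuous_radialTent.integral_pos_of_hasCompactSupport_nonneg_nonzero (x := 0)
    hasCompactSupport_radialTent radialTent_nonneg (by simp [radialTent])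

end RadialKernel

section Harmonic

variable {n : ℕ} {F : Type*} [NormedAddCommGroup F] [NormedSpace ℝ F]

lemma hasDerivAt_integral_radialTent_smul {f : EuclideanSpace ℝ (Fin n) → F}
    (hf : ContDiff ℝ 1 f) (x : EuclideanSpace ℝ (Fin n)) (t₀ : ℝ) :
    HasDerivAt (fun t : ℝ => ∫ y, radialTent y • f (x + t • y))
      (∫ y, radialTent y • fderiv ℝ f (x + t₀ • y) y) t₀ := by
  have hη := continuous_radialTent (E := EuclideanSpace ℝ (Fin n))
  have hf0 := hf.continuous
  have hf1 : Continuous (fderiv ℝ f) := hf.continuous_fderiv (by simp)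
  have hF' : Continuous fun q : ℝ × EuclideanSpace ℝ (Fin n) =>
      radialTent q.2 • fderiv ℝ f (x + q.1 • q.2) q.2 := by
    fun_prop
  obtain ⟨M, hM⟩ := ((isCompact_closedBall t₀ 1).prod
    (isCompact_closedBall (0 : EuclideanSpace ℝ (Fin n)) 1)).exists_bound_of_continuousOn
      hF'.continuousOn
  refine (hasDerivAt_integral_of_dominated_loc_of_deriv_le
    (F' := fun t y => radialTent y • fderiv ℝ f (x + t • y) y)
    (bound := (Metric.closedBall (0 : EuclideanSpace ℝ (Fin n)) 1).indicator fun _ => M)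
    (Metric.ball_mem_nhds t₀ one_pos) ?_ ?_ ?_ ?_ ?_ ?_).2
  · refine .of_forall fun t => Continuous.aestronglyMeasurable ?_
    fun_prop
  · refine Continuous.integrable_of_hasCompactSupport (by fun_prop) ?_
    exact hasCompactSupport_radialTent.smul_right
  · exact (hF'.comp (by fun_prop : Continuous fun y => (t₀, y))).aestronglyMeasurable
  · refine .of_forall fun y t ht => ?_
    by_cases hy : y ∈ Metric.closedBall (0 : EuclideanSpace ℝ (Fin n)) 1
    · rw [Set.indicator_of_mem hy]
      exact hM (t, y) ⟨Metric.ball_subset_closedBall ht, hy⟩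
    · simp [radialTent_eq_zero hy, Set.indicator_of_notMem hy]
  · exact (integrable_indicator_iff Metric.isClosed_closedBall.measurableSet).2
      (integrableOn_const (isCompact_closedBall _ _).measure_ne_top)
  · refine .of_forall fun y t _ => HasDerivAt.const_smul _ ?_
    have h := (hf.differentiable (by simp) (x + t • y)).hasFDerivAt
    refine h.comp_hasDerivAt t ?_
    simpa using ((hasDerivAt_id t).smul_const y).const_add x

lemma integral_radialTent_smul_fderiv_eq_zero {f : EuclideanSpace ℝ (Fin n) → F}
    (hf : ContDiff ℝ 2 f) (hharm : ∀ z, eLap f z = 0) (x : EuclideanSpace ℝ (Fin n)) (t : ℝ) :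
    ∫ y, radialTent y • fderiv ℝ f (x + t • y) y = 0 := by
  have hη := continuous_radialTent (E := EuclideanSpace ℝ (Fin n))
  have hηc := hasCompactSupport_radialTent (E := EuclideanSpace ℝ (Fin n))
  have hf1 : ContDiff ℝ 1 (fderiv ℝ f) := hf.fderiv_right (by norm_num)
  have hf1c := hf1.continuous
  have hf2 : Continuous (fderiv ℝ (fderiv ℝ f)) := hf1.continuous_fderiv (by simp)
  have hΨ : ∀ y v : EuclideanSpace ℝ (Fin n),
      fderiv ℝ (fun y => radialTent y ^ 2) y v = -4 * radialTent y * inner ℝ y v := fun y v => by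
    rw [(hasFDerivAt_radialTent_sq y).fderiv]; simp
  have hg : ∀ i : Fin n, ∀ y : EuclideanSpace ℝ (Fin n),
      HasFDerivAt (fun y => fderiv ℝ f (x + t • y) (EuclideanSpace.single i 1))
        ((t • fderiv ℝ (fderiv ℝ f) (x + t • y)).flip (EuclideanSpace.single i 1)) y := by
    intro i y
    have h1 : HasFDerivAt (fun y : EuclideanSpace ℝ (Fin n) => x + t • y)
        (t • ContinuousLinearMap.id ℝ _) y := ((hasFDerivAt_id y).const_smul t).const_add x
    have h2 := ((hf1.differentiable (by simp) (x + t • y)).hasFDerivAt.comp y h1).clm_apply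
      (hasFDerivAt_const (EuclideanSpace.single i (1 : ℝ)) y)
    refine h2.congr_fderiv ?_
    ext v
    simp
  have hparts : ∀ i : Fin n,
      ∫ y, (radialTent y ^ 2) • (t • fderiv ℝ (fderiv ℝ f) (x + t • y)
          (EuclideanSpace.single i 1) (EuclideanSpace.single i 1)) =
        ∫ y, (4 * radialTent y * y i) • fderiv ℝ f (x + t • y) (EuclideanSpace.single i 1) := by
    intro i
    have key := integral_smul_fderiv_eq_neg_fderiv_smul_of_integrable
      (μ := (volume : Measure (EuclideanSpace ℝ (Fin n))))
      (f := fun y => radialTent y ^ 2)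
      (g := fun y => fderiv ℝ f (x + t • y) (EuclideanSpace.single i 1))
      (v := EuclideanSpace.single i 1) ?_ ?_ ?_
      (fun y _ => (hasFDerivAt_radialTent_sq y).differentiableAt)
      (fun y _ => (hg i y).differentiableAt)
    · simp only [(hg i _).fderiv, hΨ] at key
      rw [← integral_neg] at key
      simpa [EuclideanSpace.inner_single_right] using key
    · simp only [hΨ]
      refine Continuous.integrable_of_hasCompactSupport (by fun_prop) ?_
      exact HasCompactSupport.smul_right (hηc.mul_left.mul_right)
    · simp only [(hg i _).fderiv]
      refine Continuous.integrable_of_hasCompactSupport ?_ ?_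
      · simp only [ContinuousLinearMap.flip_apply, smul_apply]
        fun_prop
      · simp only [sq]
        exact HasCompactSupport.smul_right hηc.mul_right
    · refine Continuous.integrable_of_hasCompactSupport (by fun_prop) ?_
      simp only [sq]
      exact HasCompactSupport.smul_right hηc.mul_right
  have hsum : ∀ y : EuclideanSpace ℝ (Fin n),
      radialTent y • fderiv ℝ f (x + t • y) y = (4 : ℝ)⁻¹ • ∑ i : Fin n,
        (4 * radialTent y * y i) • fderiv ℝ f (x + t • y) (EuclideanSpace.single i 1) := by
    intro y
    have hy : y = ∑ i : Fin n, y i • EuclideanSpace.single i (1 : ℝ) := by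
      simpa using ((EuclideanSpace.basisFun (Fin n) ℝ).sum_repr y).symm
    conv_lhs => rw [hy, map_sum, ← hy]
    simp only [map_smul, Finset.smul_sum, smul_smul]
    refine Finset.sum_congr rfl fun i _ => ?_
    congr 1
    ring
  simp only [hsum]
  rw [integral_smul, integral_finsetSum]
  · simp only [← hparts]
    rw [← integral_finsetSum]
    · simp only [← Finset.smul_sum]
      have : ∀ y, ∑ i : Fin n, fderiv ℝ (fderiv ℝ f) (x + t • y)
          (EuclideanSpace.single i 1) (EuclideanSpace.single i 1) = 0 := fun y => hharm (x + t • y)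
      simp [this]
    · intro i _
      refine Continuous.integrable_of_hasCompactSupport (by fun_prop) ?_
      simp only [sq]
      exact HasCompactSupport.smul_right hηc.mul_right
  · intro i _
    refine Continuous.integrable_of_hasCompactSupport (by fun_prop) ?_
    exact HasCompactSupport.smul_right (hηc.mul_left.mul_right)

/-- Mean value property of harmonic functions for the radial kernel `radialTent`. -/
lemma integral_radialTent_smul_eq [CompleteSpace F] {f : EuclideanSpace ℝ (Fin n) → F}
    (hf : ContDiff ℝ 2 f) (hharm : ∀ z, eLap f z = 0) (x : EuclideanSpace ℝ (Fin n)) (t : ℝ) :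
    ∫ y, radialTent y • f (x + t • y) =
      (∫ y : EuclideanSpace ℝ (Fin n), radialTent y) • f x := by
  have hderiv := hasDerivAt_integral_radialTent_smul (hf.of_le one_le_two) x
  have := is_const_of_deriv_eq_zero (fun s => (hderiv s).differentiableAt)
    (fun s => (hderiv s).deriv.trans (integral_radialTent_smul_fderiv_eq_zero hf hharm x s)) t 0
  simpa [integral_smul_const] using this

/-- Liouville theorem: a harmonic function on `ℝⁿ` with finite `Lᵖ` norm vanishes. -/
theorem eq_zero_of_eLap_eq_zero_of_integrable_norm_rpow [CompleteSpace F] (hn : 1 ≤ n)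
    {f : EuclideanSpace ℝ (Fin n) → F} (hf : ContDiff ℝ 2 f) (hharm : ∀ z, eLap f z = 0)
    {p : ℝ} (hp : 1 < p) (hLp : Integrable fun x => ‖f x‖ ^ p)
    (x : EuclideanSpace ℝ (Fin n)) : f x = 0 := by
  have hη := continuous_radialTent (E := EuclideanSpace ℝ (Fin n))
  have hfc := hf.continuous
  have hpq := Real.HolderConjugate.conjExponent hp
  set q := Real.conjExponent p
  set c : ℝ := ∫ y : EuclideanSpace ℝ (Fin n), radialTent y
  have hc : 0 < c := integral_radialTent_pos _
  set I : ℝ := ∫ z, ‖f z‖ ^ p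
  set K : ℝ := (∫ y : EuclideanSpace ℝ (Fin n), radialTent y ^ q) ^ (1 / q)
  have hbound : ∀ t : ℝ, 0 < t → c * ‖f x‖ ≤ ((t ^ n)⁻¹ * I) ^ (1 / p) * K := by
    intro t ht
    have hint : Integrable fun y => ‖f (x + t • y)‖ ^ p :=
      (hLp.comp_add_left x).comp_smul ht.ne'
    have hval : ∫ y, ‖f (x + t • y)‖ ^ p = (t ^ n)⁻¹ * I := by
      have h := Measure.integral_comp_smul_of_nonneg
        (volume : Measure (EuclideanSpace ℝ (Fin n))) (fun z => ‖f (x + z)‖ ^ p) t (hR := ht.le)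
      rw [h, integral_add_left_eq_self (fun z => ‖f z‖ ^ p) x]
      simp [I]
    have hmem : MemLp (fun y => ‖f (x + t • y)‖) (ENNReal.ofReal p) := by
      refine (integrable_norm_rpow_iff (Continuous.aestronglyMeasurable (by fun_prop))
        (by simpa using hpq.pos) ENNReal.ofReal_ne_top).1 ?_
      simpa [ENNReal.toReal_ofReal hpq.nonneg] using hint
    calc c * ‖f x‖ = ‖c • f x‖ := by rw [norm_smul, Real.norm_of_nonneg hc.le]
      _ = ‖∫ y, radialTent y • f (x + t • y)‖ := by
        rw [integral_radialTent_smul_eq hf hharm x t]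
      _ ≤ ∫ y, ‖radialTent y • f (x + t • y)‖ := norm_integral_le_integral_norm _
      _ = ∫ y, ‖f (x + t • y)‖ * radialTent y := by
        simp only [norm_smul, Real.norm_of_nonneg (radialTent_nonneg _), mul_comm]
      _ ≤ (∫ y, ‖f (x + t • y)‖ ^ p) ^ (1 / p) * K :=
        integral_mul_le_Lp_mul_Lq_of_nonneg hpq (.of_forall fun _ => norm_nonneg _)
          (.of_forall radialTent_nonneg) hmem
          (hη.memLp_of_hasCompactSupport hasCompactSupport_radialTent)
      _ = ((t ^ n)⁻¹ * I) ^ (1 / p) * K := by rw [hval]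
  have hlim : Filter.Tendsto (fun t : ℝ => ((t ^ n)⁻¹ * I) ^ (1 / p) * K) Filter.atTop (𝓝 0) := by
    have h := ((tendsto_inv_atTop_zero.comp (Filter.tendsto_pow_atTop (α := ℝ)
      (Nat.one_le_iff_ne_zero.1 hn))).mul_const I).rpow_const (p := 1 / p)
        (.inr hpq.one_div_nonneg)
    simpa [Real.zero_rpow hpq.inv_ne_zero] using h.mul_const K
  have hle : c * ‖f x‖ ≤ 0 :=
    ge_of_tendsto hlim (Filter.eventually_atTop.2 ⟨1, fun t ht => hbound t (by linarith)⟩)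
  exact norm_le_zero_iff.1 (nonpos_of_mul_nonpos_right hle hc)

end Harmonic

lemma ContDiff.eLap {n : ℕ} {F : Type*} [NormedAddCommGroup F] [NormedSpace ℝ F]
    {f : EuclideanSpace ℝ (Fin n) → F} (hf : ContDiff ℝ 4 f) : ContDiff ℝ 2 (eLap f) := by
  have h1 : ContDiff ℝ 3 (fderiv ℝ f) := hf.fderiv_right (by norm_num)
  have h2 : ContDiff ℝ 2 (fderiv ℝ (fderiv ℝ f)) := h1.fderiv_right (by norm_num)
  exact ContDiff.sum fun i _ => (h2.clm_apply contDiff_const).clm_apply contDiff_const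

/-- A smooth biharmonic map `φ : ℝⁿ → ℝᵐ` (i.e. `Δ(Δφ) = 0`)
whose Laplacian `Δφ` has finite `Lᵖ`-norm for some `1 < p < ∞` is harmonic:
`Δφ = 0` identically. -/
theorem biharmonic_Lp_tension_implies_harmonic
    (n m : ℕ) (hn : 1 ≤ n) (hm : 1 ≤ m)
    (φ : EuclideanSpace ℝ (Fin n) → EuclideanSpace ℝ (Fin m))
    (hφ : ContDiff ℝ (⊤ : ℕ∞) φ)
    (hbih : ∀ x, eLap (eLap φ) x = 0)
    (p : ℝ) (hp : 1 < p)
    (hLp : Integrable (fun x => ‖eLap φ x‖ ^ p) (volume : Measure (EuclideanSpace ℝ (Fin n)))) :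
    ∀ x, eLap φ x = 0 :=
  eq_zero_of_eLap_eq_zero_of_integrable_norm_rpow hn
    (ContDiff.eLap (contDiff_infty.1 hφ 4)) hbih hp hLp
end

section
/- Let E be a finite-dimensional real inner product space, F a real inner product space, f : E → F a C² map, and ε > 0. If ⟨f(x), Δf(x)⟩ ≥ 0 for all x ∈ E, where Δf(x) = Σᵢ D²f(x)(bᵢ, bᵢ) is the vector-valued Laplacian of f with respect to an orthonormal basis (bᵢ) of E, then the function v(x) = (‖f(x)‖² + ε)^{1/2} satisfies Δv(x) ≥ 0 for all x ∈ E, i.e. v is subharmonic. -/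
open RealInnerProductSpace

/-- The Laplacian of a map `f : E → F` with respect to a family
`b : Fin n → E` of vectors (to be taken an orthonormal basis): the sum of the
second directional derivatives along the `b i`. -/
noncomputable def lapWith {E F : Type*} [NormedAddCommGroup E] [NormedSpace ℝ E]
    [NormedAddCommGroup F] [NormedSpace ℝ F] {n : ℕ}
    (b : Fin n → E) (f : E → F) (x : E) : F :=
  ∑ i, fderiv ℝ (fderiv ℝ f) x (b i) (b i)

section NormSq

variable {E G : Type*} [NormedAddCommGroup E] [NormedSpace ℝ E]
  [NormedAddCommGroup G] [InnerProductSpace ℝ G]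

lemma fderiv_norm_sq_comp_apply {g : E → G} {x : E} (hg : DifferentiableAt ℝ g x) (e : E) :
    fderiv ℝ (fun y => ‖g y‖ ^ 2) x e = 2 * ⟪g x, fderiv ℝ g x e⟫ := by
  rw [hg.hasFDerivAt.norm_sq.fderiv]
  simp

lemma fderiv_fderiv_norm_sq_comp_apply {g : E → G} (hg : ContDiff ℝ 2 g) (x e : E) :
    fderiv ℝ (fderiv ℝ (fun y => ‖g y‖ ^ 2)) x e e =
      2 * (‖fderiv ℝ g x e‖ ^ 2 + ⟪g x, fderiv ℝ (fderiv ℝ g) x e e⟫) := by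
  have hg1 : Differentiable ℝ g := hg.differentiable (by norm_num)
  have hg2 : Differentiable ℝ (fderiv ℝ g) :=
    (hg.fderiv_right (m := 1) (by norm_num)).differentiable (by norm_num)
  have hq : Differentiable ℝ (fderiv ℝ (fun y => ‖g y‖ ^ 2)) :=
    ((hg.norm_sq ℝ).fderiv_right (m := 1) (by norm_num)).differentiable (by norm_num)
  have hleft : HasFDerivAt (fun y => fderiv ℝ (fun y => ‖g y‖ ^ 2) y e) _ x :=
    (hq x).hasFDerivAt.clm_apply (hasFDerivAt_const e x)
  have hDg : HasFDerivAt (fun y => fderiv ℝ g y e) _ x :=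
    (hg2 x).hasFDerivAt.clm_apply (hasFDerivAt_const e x)
  have hright := ((hg1 x).hasFDerivAt.inner ℝ hDg).const_mul 2
  rw [funext fun y => fderiv_norm_sq_comp_apply (hg1 y) e] at hleft
  have h := DFunLike.congr_fun (hleft.unique hright) e
  simp at h
  rw [h]
  ring

end NormSq

/-- If `f : E → F` is `C²` between real inner product spaces,
`E` finite-dimensional with orthonormal basis `(bᵢ)`, `ε > 0`, and
`⟪f(x), Δf(x)⟫ ≥ 0` everywhere, then `v = (‖f‖² + ε)^{1/2}` is subharmonic:
`Δv ≥ 0` everywhere. -/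
theorem subharmonic_regularized_norm
    {E F : Type*} [NormedAddCommGroup E] [InnerProductSpace ℝ E] [FiniteDimensional ℝ E]
    [NormedAddCommGroup F] [InnerProductSpace ℝ F]
    {n : ℕ} (b : OrthonormalBasis (Fin n) ℝ E)
    (f : E → F) (hf : ContDiff ℝ 2 f)
    (ε : ℝ) (hε : 0 < ε)
    (hpos : ∀ x, 0 ≤ ⟪f x, lapWith (fun i => b i) f x⟫)
    (v : E → ℝ) (hv : ∀ x, v x = (‖f x‖ ^ 2 + ε) ^ ((1 : ℝ) / 2)) :
    ∀ x, 0 ≤ lapWith (fun i => b i) v x := by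
  intro x
  have hpos' : ∀ y, 0 < ‖f y‖ ^ 2 + ε := fun y => by positivity
  have hv_eq : v = fun y => (‖f y‖ ^ 2 + ε) ^ ((1 : ℝ) / 2) := funext hv
  have hv_contDiff : ContDiff ℝ 2 v := by
    rw [hv_eq]
    exact ((hf.norm_sq ℝ).add contDiff_const).rpow_const_of_ne fun y => (hpos' y).ne'
  have hv_pos : 0 < v x := by
    rw [hv]
    exact Real.rpow_pos_of_pos (hpos' x) _
  have hv_sq : ∀ y, ‖v y‖ ^ 2 = ‖f y‖ ^ 2 + ε := fun y => by
    rw [hv, ← Real.sqrt_eq_rpow, Real.norm_eq_abs, sq_abs, Real.sq_sqrt (hpos' y).le]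
  have hD : fderiv ℝ (fun y => ‖v y‖ ^ 2) = fderiv ℝ (fun y => ‖f y‖ ^ 2) := by
    funext y
    simp only [hv_sq, fderiv_add_const]
  have key : ∀ e, ⟪f x, fderiv ℝ (fderiv ℝ f) x e e⟫ ≤ v x * fderiv ℝ (fderiv ℝ v) x e e := by
    intro e
    have h1 := fderiv_norm_sq_comp_apply (hv_contDiff.differentiable (by norm_num) x) e
    have h2 := fderiv_fderiv_norm_sq_comp_apply hv_contDiff x e
    rw [hD, fderiv_norm_sq_comp_apply (hf.differentiable (by norm_num) x)] at h1
    rw [hD, fderiv_fderiv_norm_sq_comp_apply hf] at h2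
    simp only [RCLike.inner_apply, conj_trivial, Real.norm_eq_abs, sq_abs] at h1 h2
    have hgrad : (fderiv ℝ v x e) ^ 2 ≤ ‖fderiv ℝ f x e‖ ^ 2 := by
      have hcs := abs_real_inner_le_norm (f x) (fderiv ℝ f x e)
      have hfv : ‖f x‖ ≤ v x := by
        have := hv_sq x
        rw [Real.norm_eq_abs, sq_abs] at this
        exact abs_norm (f x) ▸ abs_le_of_sq_le_sq (by linarith) hv_pos.le
      rw [mul_left_cancel₀ two_ne_zero h1, abs_mul, abs_of_pos hv_pos, mul_comm] at hcs
      have habs : |fderiv ℝ v x e| ≤ ‖fderiv ℝ f x e‖ :=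
        le_of_mul_le_mul_left
          (hcs.trans (mul_le_mul_of_nonneg_right hfv (norm_nonneg _))) hv_pos
      rw [← sq_abs]
      gcongr
    linarith
  refine nonneg_of_mul_nonneg_right ((hpos x).trans ?_) hv_pos
  simp only [lapWith, inner_sum, Finset.mul_sum]
  exact Finset.sum_le_sum fun i _ => key (b i)
end

section
/- Let n ≥ 1 and let X : ℝⁿ → ℝⁿ be a C¹ vector field. Define div X(x) = Σᵢ ⟨DX(x)(eᵢ), eᵢ⟩ for the standard orthonormal basis (eᵢ) of ℝⁿ (the trace of the Fréchet derivative). If ∫_{ℝⁿ} ‖X(x)‖ dx < ∞ and div X is Lebesgue integrable on ℝⁿ, then ∫_{ℝⁿ} div X(x) dx = 0. -/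
open MeasureTheory RealInnerProductSpace

/-- The divergence of a vector field `X : ℝⁿ → ℝⁿ`: the trace of its Fréchet
derivative, computed via the standard orthonormal basis. -/
noncomputable def eDiv {n : ℕ} (X : EuclideanSpace ℝ (Fin n) → EuclideanSpace ℝ (Fin n))
    (x : EuclideanSpace ℝ (Fin n)) : ℝ :=
  ∑ i : Fin n, ⟪fderiv ℝ X x (EuclideanSpace.single i 1), EuclideanSpace.single i 1⟫

theorem sum_apply_single_mul_inner {n : ℕ} (L : EuclideanSpace ℝ (Fin n) →L[ℝ] ℝ)
    (y : EuclideanSpace ℝ (Fin n)) :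
    ∑ i : Fin n, L (EuclideanSpace.single i 1) * ⟪EuclideanSpace.single i (1 : ℝ), y⟫ = L y := by
  conv_rhs => rw [← (EuclideanSpace.basisFun (Fin n) ℝ).sum_repr' y]
  simp [mul_comm]

/-- Integration by parts of a compactly supported `C¹` function against a divergence. -/
theorem integral_mul_eDiv_eq_neg {n : ℕ} {η : EuclideanSpace ℝ (Fin n) → ℝ}
    {X : EuclideanSpace ℝ (Fin n) → EuclideanSpace ℝ (Fin n)}
    (hη : ContDiff ℝ 1 η) (hsupp : HasCompactSupport η) (hX : ContDiff ℝ 1 X) :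
    ∫ x, η x * eDiv X x = -∫ x, fderiv ℝ η x (X x) := by
  have hη' : Continuous (fderiv ℝ η) := hη.continuous_fderiv one_ne_zero
  have hX' : Continuous (fderiv ℝ X) := hX.continuous_fderiv one_ne_zero
  have hηc := hη.continuous
  have hXc := hX.continuous
  have h1 (i : Fin n) : Integrable (fun x => fderiv ℝ η x (EuclideanSpace.single i 1) *
      ⟪EuclideanSpace.single i (1 : ℝ), X x⟫) :=
    Continuous.integrable_of_hasCompactSupport (by fun_prop)
      (hsupp.fderiv_apply ℝ _).mul_right
  have h2 (i : Fin n) : Integrable (fun x => η x *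
      ⟪EuclideanSpace.single i (1 : ℝ), fderiv ℝ X x (EuclideanSpace.single i 1)⟫) :=
    Continuous.integrable_of_hasCompactSupport (by fun_prop) hsupp.mul_right
  have h3 (i : Fin n) : Integrable (fun x => η x * ⟪EuclideanSpace.single i (1 : ℝ), X x⟫) :=
    Continuous.integrable_of_hasCompactSupport (by fun_prop) hsupp.mul_right
  have parts (i : Fin n) := integral_bilinear_fderiv_right_eq_neg_left_of_integrable
    (B := ((ContinuousLinearMap.mul ℝ ℝ).flip ∘L
      innerSL ℝ (EuclideanSpace.single i (1 : ℝ))).flip) (h1 i) (h2 i) (h3 i)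
    (fun x _ => hη.differentiable one_ne_zero x) (fun x _ => hX.differentiable one_ne_zero x)
  calc ∫ x, η x * eDiv X x
      = ∫ x, ∑ i : Fin n, η x * ⟪EuclideanSpace.single i (1 : ℝ),
          fderiv ℝ X x (EuclideanSpace.single i 1)⟫ := by
        simp only [eDiv, Finset.mul_sum, real_inner_comm]
    _ = ∑ i : Fin n, -∫ x, fderiv ℝ η x (EuclideanSpace.single i 1) *
          ⟪EuclideanSpace.single i (1 : ℝ), X x⟫ := by
        rw [integral_finsetSum _ fun i _ => h2 i]
        exact Finset.sum_congr rfl fun i _ => parts i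
    _ = -∫ x, fderiv ℝ η x (X x) := by
        rw [Finset.sum_neg_distrib, ← integral_finsetSum _ fun i _ => h1 i]
        simp only [sum_apply_single_mul_inner]

open Filter Topology

/-- Gaffney's theorem on `ℝⁿ`. If `X` is a `C¹` vector field
on `ℝⁿ` with `∫ ‖X‖ < ∞` and `div X` Lebesgue integrable, then
`∫ div X = 0`. -/
theorem gaffney_euclidean
    (n : ℕ) (hn : 1 ≤ n)
    (X : EuclideanSpace ℝ (Fin n) → EuclideanSpace ℝ (Fin n))
    (hX : ContDiff ℝ 1 X)
    (hX1 : Integrable (fun x => ‖X x‖) (volume : Measure (EuclideanSpace ℝ (Fin n))))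
    (hdiv : Integrable (eDiv X) (volume : Measure (EuclideanSpace ℝ (Fin n)))) :
    ∫ x, eDiv X x ∂(volume : Measure (EuclideanSpace ℝ (Fin n))) = 0 := by
  let φ : ContDiffBump (0 : EuclideanSpace ℝ (Fin n)) := ⟨1, 2, one_pos, one_lt_two⟩
  have hφ : ContDiff ℝ 1 φ := φ.contDiff
  obtain ⟨C, hC⟩ := (φ.hasCompactSupport.fderiv ℝ).exists_bound_of_continuous
    (hφ.continuous_fderiv one_ne_zero)
  let c : ℕ → ℝ := fun k => 1 / ((k : ℝ) + 1)
  have hc : Tendsto c atTop (𝓝 0) := tendsto_one_div_add_atTop_nhds_zero_nat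
  have hc0 (k : ℕ) : 0 < c k := Nat.one_div_pos_of_nat
  have parts (k : ℕ) : ∫ x, φ (c k • x) * eDiv X x = -∫ x, c k * fderiv ℝ φ (c k • x) (X x) := by
    rw [integral_mul_eDiv_eq_neg (η := fun x => φ (c k • x))
      (hφ.comp (contDiff_const_smul _)) (φ.hasCompactSupport.comp_smul (hc0 k).ne') hX]
    simp [fderiv_comp_smul]
  have cutoff_tendsto : Tendsto (fun k => ∫ x, φ (c k • x) * eDiv X x) atTop
      (𝓝 (∫ x, eDiv X x)) := by
    refine tendsto_integral_of_dominated_convergence (fun x => ‖eDiv X x‖)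
      (fun k => ?_) hdiv.norm (fun k => .of_forall fun x => ?_) (.of_forall fun x => ?_)
    · exact (φ.continuous.comp (continuous_const_smul _)).aestronglyMeasurable.mul hdiv.1
    · rw [norm_mul, Real.norm_of_nonneg φ.nonneg]
      exact mul_le_of_le_one_left (norm_nonneg _) φ.le_one
    · have hx : Tendsto (fun k => c k • x) atTop (𝓝 0) := by
        simpa using hc.smul_const x
      refine tendsto_const_nhds.congr' ?_
      filter_upwards [hx.eventually φ.eventuallyEq_one] with k hk
      simp [hk]
  have gradient_tendsto : Tendsto (fun k => ∫ x, c k * fderiv ℝ φ (c k • x) (X x)) atTop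
      (𝓝 0) := by
    have hlim : Tendsto (fun k => c k * (C * ∫ x, ‖X x‖)) atTop (𝓝 0) := by
      simpa using hc.mul_const (C * ∫ x, ‖X x‖)
    refine squeeze_zero_norm (fun k => ?_) hlim
    rw [integral_const_mul, norm_mul, Real.norm_of_nonneg (hc0 k).le, ← integral_const_mul]
    exact mul_le_mul_of_nonneg_left (norm_integral_le_of_norm_le (hX1.const_mul C)
      (.of_forall fun x => ContinuousLinearMap.le_of_opNorm_le _ (hC _) _)) (hc0 k).le
  simpa using tendsto_nhds_unique (cutoff_tendsto.congr parts) gradient_tendsto.neg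
end
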